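/- Let ρ : (0,∞) → [0,∞) be measurable and regard it as a radial function on ℝ³ via ρ(x) = ρ(|x|). If the convolution with the Newton kernel 1/|x| is defined (e.g. ∫₀^∞ s²ρ(s)/max(r,s) ds < ∞ for all r > 0), then for every x ∈ ℝ³ with r = |x|: ∫_{ℝ³} ρ(y)/|x−y| dy = 4π ∫₀^∞ s²ρ(s)/max(r,s) ds. -/

import Mathlib

noncomputable section
open MeasureTheory Real Set Filter

abbrev R3 : Type := EuclideanSpace ℝ (Fin 3)

lemma lintegral_polar_iterated (g : ℝ × ℝ → ENNReal) (hg : Measurable g) :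
    ∫⁻ p, g p = ∫⁻ s in Ioi (0 : ℝ), ∫⁻ θ in Ioo (-π) π,
      ENNReal.ofReal s * g (s * cos θ, s * sin θ) := by
  rw [← lintegral_comp_polarCoord_symm, polarCoord_target, Measure.volume_eq_prod,
    ← Measure.prod_restrict, lintegral_prod]
  · simp [polarCoord_symm_apply]
  · simp only [polarCoord_symm_apply, smul_eq_mul]
    fun_prop

lemma lintegral_plane_radial (g : ℝ → ENNReal) (hg : Measurable g) :
    ∫⁻ q : ℝ × ℝ, g (q.1 ^ 2 + q.2 ^ 2) =
      ENNReal.ofReal (2 * π) * ∫⁻ u in Ioi (0 : ℝ), ENNReal.ofReal u * g (u ^ 2) := by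
  rw [lintegral_polar_iterated (fun q => g (q.1 ^ 2 + q.2 ^ 2)) (by fun_prop),
    ← lintegral_const_mul _ (by fun_prop)]
  refine lintegral_congr fun s => ?_
  have h (θ : ℝ) : (s * cos θ) ^ 2 + (s * sin θ) ^ 2 = s ^ 2 := by
    linear_combination s ^ 2 * cos_sq_add_sin_sq θ
  simp only [h, lintegral_const, Measure.restrict_apply_univ, Real.volume_Ioo]
  rw [mul_comm]
  ring_nf

lemma lintegral_upper_half_plane (g : ℝ × ℝ → ENNReal) (hg : Measurable g) :
    ∫⁻ t, ∫⁻ u in Ioi (0 : ℝ), g (t, u) = ∫⁻ s in Ioi (0 : ℝ), ∫⁻ θ in Ioo 0 π,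
      ENNReal.ofReal s * g (s * cos θ, s * sin θ) := by
  have hS : MeasurableSet {p : ℝ × ℝ | 0 < p.2} := measurableSet_lt measurable_const measurable_snd
  have h := lintegral_polar_iterated _ (hg.indicator hS)
  rw [Measure.volume_eq_prod, lintegral_prod _ (hg.indicator hS).aemeasurable] at h
  have hl (t : ℝ) : ∫⁻ u in Ioi (0 : ℝ), g (t, u) =
      ∫⁻ u, {p : ℝ × ℝ | 0 < p.2}.indicator g (t, u) := by
    rw [← lintegral_indicator measurableSet_Ioi]
    rfl
  simp_rw [hl, h]
  refine setLIntegral_congr_fun measurableSet_Ioi fun s hs => ?_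
  have hs : 0 < s := hs
  rw [← lintegral_indicator measurableSet_Ioo, ← lintegral_indicator measurableSet_Ioo]
  refine lintegral_congr fun θ => ?_
  by_cases h1 : θ ∈ Ioo 0 π
  · have h2 : θ ∈ Ioo (-π) π := ⟨by linarith [h1.1, pi_pos], h1.2⟩
    have h3 : 0 < s * sin θ := mul_pos hs (sin_pos_of_mem_Ioo h1)
    rw [indicator_of_mem h2, indicator_of_mem h1, indicator_of_mem (by exact h3)]
  · by_cases h2 : θ ∈ Ioo (-π) π
    · have h3 : ¬ 0 < s * sin θ := by
        have : θ ≤ 0 := by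
          by_contra! h
          exact h1 ⟨h, h2.2⟩
        exact not_lt.2 (mul_nonpos_of_nonneg_of_nonpos hs.le
          (sin_nonpos_of_nonpos_of_neg_pi_le this h2.1.le))
      rw [indicator_of_mem h2, indicator_of_notMem h1, indicator_of_notMem (by exact h3), mul_zero]
    · rw [indicator_of_notMem h2, indicator_of_notMem h1]

lemma lintegral_axisymmetric (g : ℝ × ℝ → ENNReal) (hg : Measurable g) :
    ∫⁻ y : R3, g (y 0, y 1 ^ 2 + y 2 ^ 2) =
      ENNReal.ofReal (2 * π) * ∫⁻ s in Ioi (0 : ℝ), ∫⁻ θ in Ioo 0 π,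
        ENNReal.ofReal (s ^ 2 * sin θ) * g (s * cos θ, (s * sin θ) ^ 2) := by
  have e2 := volume_preserving_piFinSuccAbove (fun _ : Fin 3 => ℝ) 0
  have e3 := (MeasurePreserving.id (volume : Measure ℝ)).prod
    (volume_preserving_finTwoArrow ℝ)
  have hm : Measurable fun p : ℝ × ℝ × ℝ => g (p.1, p.2.1 ^ 2 + p.2.2 ^ 2) := by fun_prop
  have hF : ∫⁻ y : R3, g (y 0, y 1 ^ 2 + y 2 ^ 2) =
      ∫⁻ p : ℝ × ℝ × ℝ, g (p.1, p.2.1 ^ 2 + p.2.2 ^ 2) := by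
    exact ((e3.comp e2).comp
      (EuclideanSpace.volume_preserving_symm_measurableEquiv_toLp (Fin 3))).lintegral_comp hm
  rw [hF, Measure.volume_eq_prod, lintegral_prod _ hm.aemeasurable]
  have h2 (t : ℝ) := lintegral_plane_radial (fun v => g (t, v)) (by fun_prop)
  simp_rw [h2]
  rw [lintegral_const_mul _ (by fun_prop),
    lintegral_upper_half_plane (fun p => ENNReal.ofReal p.2 * g (p.1, p.2 ^ 2)) (by fun_prop)]
  congr 1
  refine setLIntegral_congr_fun measurableSet_Ioi fun s hs => lintegral_congr fun θ => ?_
  have hs : 0 < s := hs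
  rw [← mul_assoc, ← ENNReal.ofReal_mul hs.le]
  ring_nf

lemma lintegral_sin_div_dist {r s : ℝ} (hr : 0 < r) (hs : 0 < s) :
    ∫⁻ θ in Ioo 0 π, ENNReal.ofReal (sin θ / √((r - s * cos θ) ^ 2 + (s * sin θ) ^ 2)) =
      ENNReal.ofReal (2 / max r s) := by
  set Q : ℝ → ℝ := fun θ => (r - s * cos θ) ^ 2 + (s * sin θ) ^ 2 with hQ
  have hQ' (θ : ℝ) : Q θ = r ^ 2 + s ^ 2 - 2 * r * s * cos θ := by
    simp only [hQ]
    linear_combination s ^ 2 * cos_sq_add_sin_sq θ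
  have hcont : ContinuousOn (fun θ => √(Q θ) / (r * s)) (Icc 0 π) := by
    simp only [hQ]; fun_prop
  have hderiv : ∀ θ ∈ Ioo 0 π,
      HasDerivAt (fun θ => √(Q θ) / (r * s)) (sin θ / √(Q θ)) θ := by
    intro θ hθ
    have hpos : 0 < Q θ := by
      have : 0 < s * sin θ := mul_pos hs (sin_pos_of_mem_Ioo hθ)
      simp only [hQ]; positivity
    have h1 : HasDerivAt Q (2 * r * s * sin θ) θ := by
      rw [funext hQ']
      simpa using ((hasDerivAt_cos θ).const_mul (2 * r * s)).const_sub (r ^ 2 + s ^ 2)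
    have hsq := (sqrt_pos.2 hpos).ne'
    refine ((h1.sqrt hpos.ne').div_const (r * s)).congr_deriv ?_
    field_simp
  have hnn : ∀ θ ∈ Ioo 0 π, 0 ≤ sin θ / √(Q θ) := fun θ hθ =>
    div_nonneg (sin_pos_of_mem_Ioo hθ).le (sqrt_nonneg _)
  have hii := intervalIntegral.integrableOn_deriv_of_nonneg hcont hderiv hnn
  have hI := intervalIntegral.integral_eq_sub_of_hasDerivAt_of_le pi_pos.le hcont hderiv
    ((intervalIntegrable_iff_integrableOn_Ioc_of_le pi_pos.le).2 hii)
  rw [intervalIntegral.integral_of_le pi_pos.le, integral_Ioc_eq_integral_Ioo] at hI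
  rw [← ofReal_integral_eq_lintegral_ofReal (hii.mono_set Ioo_subset_Ioc_self)
    ((ae_restrict_iff' measurableSet_Ioo).2 (.of_forall hnn)), hI]
  congr 1
  have h0 : Q 0 = (r - s) ^ 2 := by simp [hQ]
  have hp : Q π = (r + s) ^ 2 := by simp [hQ]
  rw [h0, hp, sqrt_sq_eq_abs, sqrt_sq_eq_abs, abs_of_pos (add_pos hr hs)]
  rcases le_total r s with h | h
  · rw [max_eq_right h, abs_of_nonpos (by linarith)]
    field_simp; ring
  · rw [max_eq_left h, abs_of_nonneg (by linarith)]
    field_simp; ring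

lemma exists_isometry_axis {x : R3} (hx : x ≠ 0) :
    ∃ e : R3 ≃ₗᵢ[ℝ] R3, e x = EuclideanSpace.single 0 ‖x‖ := by
  have hv : Orthonormal ℝ (({0} : Set (Fin 3)).domRestrict fun _ => ‖x‖⁻¹ • x) :=
    ⟨fun _ => by simp [norm_smul, hx],
      fun i j hij => (hij (Subsingleton.elim i j)).elim⟩
  obtain ⟨b, hb⟩ := hv.exists_orthonormalBasis_extension_of_card_eq (by simp)
  have hx' : x = ‖x‖ • b 0 := by
    rw [hb 0 rfl, smul_smul, mul_inv_cancel₀ (norm_ne_zero_iff.2 hx), one_smul]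
  refine ⟨b.repr, ?_⟩
  conv_lhs => rw [hx', map_smul, b.repr_self]
  ext i
  fin_cases i <;> simp

lemma lintegral_newton_radial (f : ℝ → ENNReal) (hf : Measurable f) {x : R3} (hx : x ≠ 0) :
    ∫⁻ y : R3, f ‖y‖ * ENNReal.ofReal (1 / ‖x - y‖) =
      ENNReal.ofReal (4 * π) * ∫⁻ s in Ioi (0 : ℝ), f s * ENNReal.ofReal (s ^ 2 / max ‖x‖ s) := by
  obtain ⟨e, he⟩ := exists_isometry_axis hx
  set r := ‖x‖ with hr
  have hr0 : 0 < r := norm_pos_iff.2 hx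
  set g : ℝ × ℝ → ENNReal := fun p =>
    f (√(p.1 ^ 2 + p.2)) * ENNReal.ofReal (1 / √((r - p.1) ^ 2 + p.2)) with hgdef
  have hg : Measurable g := by fun_prop
  have h1 : ∫⁻ y : R3, f ‖y‖ * ENNReal.ofReal (1 / ‖x - y‖) =
      ∫⁻ y : R3, g (y 0, y 1 ^ 2 + y 2 ^ 2) := by
    have hm : Measurable fun y : R3 => g (y 0, y 1 ^ 2 + y 2 ^ 2) := by fun_prop
    rw [← e.measurePreserving.lintegral_comp hm]
    refine lintegral_congr fun y => ?_
    simp only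
    rw [← e.norm_map y, ← e.norm_map (x - y), map_sub, he]
    generalize e y = z
    simp [hgdef, EuclideanSpace.norm_eq, Fin.sum_univ_three, add_assoc]
  rw [h1, lintegral_axisymmetric g hg, show 4 * π = 2 * π * 2 by ring,
    ENNReal.ofReal_mul (q := 2) (by positivity), mul_assoc]
  congr 1
  rw [← lintegral_const_mul _ (by fun_prop)]
  refine setLIntegral_congr_fun measurableSet_Ioi fun s hs => ?_
  have hs : 0 < s := hs
  have h2 (θ : ℝ) (hθ : θ ∈ Ioo 0 π) :
      ENNReal.ofReal (s ^ 2 * sin θ) * g (s * cos θ, (s * sin θ) ^ 2) =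
      f s * ENNReal.ofReal (s ^ 2) *
        ENNReal.ofReal (sin θ / √((r - s * cos θ) ^ 2 + (s * sin θ) ^ 2)) := by
    have h3 : (s * cos θ) ^ 2 + (s * sin θ) ^ 2 = s ^ 2 := by
      linear_combination s ^ 2 * cos_sq_add_sin_sq θ
    simp only [hgdef, h3, sqrt_sq hs.le]
    rw [div_eq_mul_one_div (sin θ), ENNReal.ofReal_mul (sin_pos_of_mem_Ioo hθ).le,
      ENNReal.ofReal_mul (sq_nonneg s)]
    ring
  rw [setLIntegral_congr_fun measurableSet_Ioo h2, lintegral_const_mul _ (by fun_prop),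
    lintegral_sin_div_dist hr0 hs, mul_assoc, ← ENNReal.ofReal_mul (sq_nonneg s),
    mul_left_comm, ← ENNReal.ofReal_mul zero_le_two]
  ring_nf

/-- Newton's formula for radial functions: for measurable nonnegative `ρ` on
`(0,∞)` whose convolution with the Newton kernel is defined,
`∫_{ℝ³} ρ(|y|)/|x−y| dy = 4π ∫₀^∞ s²ρ(s)/max(r,s) ds` with `r = |x|`. -/
theorem newton_formula_radial (ρ : ℝ → ℝ) (hmeas : Measurable ρ)
    (hpos : ∀ s ∈ Set.Ioi (0:ℝ), 0 ≤ ρ s)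
    (hint : ∀ r > (0:ℝ), IntegrableOn (fun s => s ^ 2 * ρ s / max r s) (Set.Ioi 0) volume) :
    ∀ x : R3,
      (∫ y : R3, ρ ‖y‖ / ‖x - y‖)
        = 4 * π * ∫ s in Set.Ioi (0:ℝ), s ^ 2 * ρ s / max ‖x‖ s := by
  intro x
  rcases eq_or_ne x 0 with rfl | hx
  · simp only [zero_sub, norm_neg, norm_zero]
    rw [integral_fun_norm_addHaar volume (fun s => ρ s / s)]
    have hv : volume.real (Metric.ball (0 : R3) 1) = 4 / 3 * π := by
      rw [Measure.real, EuclideanSpace.volume_ball_fin_three]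
      simp only [ENNReal.ofReal_one, one_pow, one_mul]
      rw [ENNReal.toReal_ofReal (by positivity)]
      ring
    rw [hv]
    simp only [finrank_euclideanSpace, Fintype.card_fin, nsmul_eq_mul, smul_eq_mul]
    rw [← mul_assoc]
    congr 1
    · push_cast; ring
    · refine setIntegral_congr_fun measurableSet_Ioi fun s hs => ?_
      have hs : 0 < s := hs
      simp only [max_eq_right hs.le]
      norm_num
      ring
  · have hnn : 0 ≤ᵐ[volume] fun y : R3 => ρ ‖y‖ / ‖x - y‖ := by
      filter_upwards [Measure.ae_ne volume (0 : R3)] with y hy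
      exact div_nonneg (hpos _ (norm_pos_iff.2 hy)) (norm_nonneg _)
    have hnn' : ∀ s ∈ Ioi (0 : ℝ), 0 ≤ s ^ 2 * ρ s / max ‖x‖ s := fun s hs =>
      div_nonneg (mul_nonneg (sq_nonneg s) (hpos s hs)) (le_max_of_le_left (norm_nonneg _))
    rw [integral_eq_lintegral_of_nonneg_ae hnn (Measurable.aestronglyMeasurable (by fun_prop)),
      integral_eq_lintegral_of_nonneg_ae
        ((ae_restrict_iff' measurableSet_Ioi).2 (.of_forall hnn')) (Measurable.aestronglyMeasurable (by fun_prop))]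
    have hl : ∫⁻ y : R3, ENNReal.ofReal (ρ ‖y‖ / ‖x - y‖) =
        ∫⁻ y : R3, ENNReal.ofReal (ρ ‖y‖) * ENNReal.ofReal (1 / ‖x - y‖) := by
      refine lintegral_congr fun y => ?_
      rw [div_eq_mul_one_div, ENNReal.ofReal_mul' (by positivity)]
    have hr : ∫⁻ s in Ioi (0 : ℝ), ENNReal.ofReal (s ^ 2 * ρ s / max ‖x‖ s) =
        ∫⁻ s in Ioi (0 : ℝ), ENNReal.ofReal (ρ s) * ENNReal.ofReal (s ^ 2 / max ‖x‖ s) := by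
      refine setLIntegral_congr_fun measurableSet_Ioi fun s hs => ?_
      rw [← ENNReal.ofReal_mul (hpos s hs), mul_comm, mul_div_assoc]
    rw [hl, hr, lintegral_newton_radial (fun s => ENNReal.ofReal (ρ s)) (by fun_prop) hx,
      ENNReal.toReal_mul, ENNReal.toReal_ofReal (by positivity)]
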